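/- Suppose |log(P x / Q x)| ≤ B for all x ∈ α and |log(V y / U y)| ≤ B for all y ∈ β, where B ≥ 0. Then for every η ∈ [0, 1], E_{QU}(−(1−η)·(m₁·D(Q‖P) + m₂·D(U‖V))) ≥ (η²/(4·e^{5B}))·(m₁·D(Q‖P) + m₂·D(U‖V)). -/

import Mathlib

/-- KL divergence between two (positive) pmfs on a finite type. -/
noncomputable def klDiv {α : Type*} [Fintype α] (p q : α → ℝ) : ℝ :=
  ∑ x, p x * Real.log (p x / q x)

/-- ψ_{QU}(t) = m₁·log(∑_x Q x·(P x/Q x)^t) + m₂·log(∑_y U y·(V y/U y)^t). -/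
noncomputable def psiQU {α β : Type*} [Fintype α] [Fintype β]
    (P Q : α → ℝ) (V U : β → ℝ) (m₁ m₂ t : ℝ) : ℝ :=
  m₁ * Real.log (∑ x, Q x * (P x / Q x) ^ t) +
    m₂ * Real.log (∑ y, U y * (V y / U y) ^ t)

/-- E_{QU}(θ) = sup_{t∈[0,1]} (t·θ − ψ_{QU}(t)). -/
noncomputable def EQU {α β : Type*} [Fintype α] [Fintype β]
    (P Q : α → ℝ) (V U : β → ℝ) (m₁ m₂ θ : ℝ) : ℝ :=
  sSup ((fun t : ℝ => t * θ - psiQU P Q V U m₁ m₂ t) '' Set.Icc 0 1)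

/-- Second-order Taylor expansion of `exp` at `0` with Lagrange remainder. -/
theorem exists_exp_eq_quadratic (u : ℝ) :
    ∃ c : ℝ, |c| ≤ |u| ∧ Real.exp u = 1 + u + Real.exp c * u ^ 2 / 2 := by
  rcases eq_or_ne u 0 with rfl | hu
  · exact ⟨0, by simp⟩
  obtain ⟨c, hc, h⟩ := taylor_mean_remainder_lagrange_iteratedDeriv (n := 1) hu.symm
    (Real.contDiff_exp.contDiffOn (s := Set.uIcc 0 u))
  refine ⟨c, ?_, ?_⟩
  · have := Set.abs_sub_left_of_mem_uIcc (Set.uIoo_subset_uIcc_self hc)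
    simpa using this
  · have hderiv : derivWithin Real.exp (Set.uIcc 0 u) 0 = 1 := by
      rw [(Real.hasDerivAt_exp 0).hasDerivWithinAt.derivWithin
        (uniqueDiffOn_uIcc hu.symm 0 Set.left_mem_uIcc), Real.exp_zero]
    simp [taylorWithinEval_succ, iteratedDerivWithin_one, hderiv, iteratedDeriv_eq_iterate] at h
    linarith

theorem exp_sub_one_sub_le_of_abs_le {u B : ℝ} (hu : |u| ≤ B) :
    Real.exp u - 1 - u ≤ Real.exp B * u ^ 2 / 2 := by
  obtain ⟨c, hc, h⟩ := exists_exp_eq_quadratic u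
  have hcB : Real.exp c ≤ Real.exp B := Real.exp_le_exp.2 ((le_abs_self c).trans (hc.trans hu))
  nlinarith [mul_le_mul_of_nonneg_right hcB (sq_nonneg u)]

theorem le_exp_sub_one_sub_of_abs_le {u B : ℝ} (hu : |u| ≤ B) :
    Real.exp (-B) * u ^ 2 / 2 ≤ Real.exp u - 1 - u := by
  obtain ⟨c, hc, h⟩ := exists_exp_eq_quadratic u
  have hcB : Real.exp (-B) ≤ Real.exp c :=
    Real.exp_le_exp.2 (abs_le.1 (hc.trans hu)).1
  nlinarith [mul_le_mul_of_nonneg_right hcB (sq_nonneg u)]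

theorem exp_mul_sub_one_sub_le {L B t : ℝ} (hL : |L| ≤ B) (ht : t ∈ Set.Icc (0 : ℝ) 1) :
    Real.exp (t * L) - 1 - t * L ≤ t ^ 2 * Real.exp (2 * B) * (Real.exp L - 1 - L) := by
  have htL : |t * L| ≤ B := by
    rw [abs_mul, abs_of_nonneg ht.1]
    exact (mul_le_of_le_one_left (abs_nonneg L) ht.2).trans hL
  calc Real.exp (t * L) - 1 - t * L ≤ Real.exp B * (t * L) ^ 2 / 2 :=
        exp_sub_one_sub_le_of_abs_le htL
    _ = t ^ 2 * Real.exp (2 * B) * (Real.exp (-B) * L ^ 2 / 2) := by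
        rw [show Real.exp B = Real.exp (2 * B) * Real.exp (-B) by
          rw [← Real.exp_add]; ring_nf]
        ring
    _ ≤ _ := by
        gcongr
        exact le_exp_sub_one_sub_of_abs_le hL

section LogMGF

variable {α : Type*} [Fintype α] {P Q : α → ℝ}

theorem klDiv_eq_neg_sum (P Q : α → ℝ) :
    klDiv Q P = -∑ x, Q x * Real.log (P x / Q x) := by
  rw [klDiv, ← Finset.sum_neg_distrib]
  refine Finset.sum_congr rfl fun x _ => ?_
  rw [← inv_div, Real.log_inv, mul_neg]

theorem klDiv_eq_sum_exp_sub (hP : ∀ x, 0 < P x) (hPsum : ∑ x, P x = 1)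
    (hQ : ∀ x, 0 < Q x) (hQsum : ∑ x, Q x = 1) :
    klDiv Q P = ∑ x, Q x * (Real.exp (Real.log (P x / Q x)) - 1 - Real.log (P x / Q x)) := by
  have h : ∀ x, Q x * (Real.exp (Real.log (P x / Q x)) - 1 - Real.log (P x / Q x)) =
      P x - Q x - Q x * Real.log (P x / Q x) := fun x => by
    rw [Real.exp_log (div_pos (hP x) (hQ x)), mul_sub, mul_sub, mul_div_cancel₀ _ (hQ x).ne',
      mul_one]
  simp_rw [h, Finset.sum_sub_distrib, hPsum, hQsum, klDiv_eq_neg_sum]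
  ring

theorem klDiv_nonneg_of_pos (hP : ∀ x, 0 < P x) (hPsum : ∑ x, P x = 1)
    (hQ : ∀ x, 0 < Q x) (hQsum : ∑ x, Q x = 1) : 0 ≤ klDiv Q P := by
  rw [klDiv_eq_sum_exp_sub hP hPsum hQ hQsum]
  refine Finset.sum_nonneg fun x _ => mul_nonneg (hQ x).le ?_
  linarith [Real.add_one_le_exp (Real.log (P x / Q x))]

theorem log_sum_mul_rpow_le [Nonempty α] (hP : ∀ x, 0 < P x) (hPsum : ∑ x, P x = 1)
    (hQ : ∀ x, 0 < Q x) (hQsum : ∑ x, Q x = 1) {B t : ℝ}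
    (hbdd : ∀ x, |Real.log (P x / Q x)| ≤ B) (ht : t ∈ Set.Icc (0 : ℝ) 1) :
    Real.log (∑ x, Q x * (P x / Q x) ^ t) ≤
      -(t * klDiv Q P) + t ^ 2 * Real.exp (2 * B) * klDiv Q P := by
  have hr : ∀ x, 0 < P x / Q x := fun x => div_pos (hP x) (hQ x)
  have hpos : 0 < ∑ x, Q x * (P x / Q x) ^ t :=
    Finset.sum_pos (fun x _ => mul_pos (hQ x) (Real.rpow_pos_of_pos (hr x) t))
      Finset.univ_nonempty
  have hsum : ∑ x, Q x * (P x / Q x) ^ t - 1 + t * klDiv Q P =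
      ∑ x, Q x * (Real.exp (t * Real.log (P x / Q x)) - 1 - t * Real.log (P x / Q x)) := by
    simp_rw [mul_sub, Finset.sum_sub_distrib, mul_one, hQsum, klDiv_eq_neg_sum,
      Real.rpow_def_of_pos (hr _), mul_left_comm _ t, ← Finset.mul_sum, mul_comm t]
    ring
  have hle : ∑ x, Q x * (Real.exp (t * Real.log (P x / Q x)) - 1 - t * Real.log (P x / Q x)) ≤
      t ^ 2 * Real.exp (2 * B) * klDiv Q P := by
    rw [klDiv_eq_sum_exp_sub hP hPsum hQ hQsum, Finset.mul_sum]
    refine Finset.sum_le_sum fun x _ => ?_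
    rw [mul_left_comm]
    exact mul_le_mul_of_nonneg_left (exp_mul_sub_one_sub_le (hbdd x) ht) (hQ x).le
  linarith [Real.log_le_sub_one_of_pos hpos]

theorem continuous_log_sum_mul_rpow [Nonempty α] (hP : ∀ x, 0 < P x) (hQ : ∀ x, 0 < Q x) :
    Continuous fun t : ℝ => Real.log (∑ x, Q x * (P x / Q x) ^ t) := by
  have hr : ∀ x, 0 < P x / Q x := fun x => div_pos (hP x) (hQ x)
  refine Continuous.log ?_ fun t => (Finset.sum_pos
    (fun x _ => mul_pos (hQ x) (Real.rpow_pos_of_pos (hr x) t)) Finset.univ_nonempty).ne'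
  exact continuous_finsetSum _ fun x _ =>
    continuous_const.mul (Real.continuous_const_rpow (hr x).ne')

end LogMGF

theorem EQU_lower_bound
    {α β : Type*} [Fintype α] [Nonempty α] [Fintype β] [Nonempty β]
    (P Q : α → ℝ) (V U : β → ℝ)
    (hP : ∀ x, 0 < P x) (hPsum : ∑ x, P x = 1)
    (hQ : ∀ x, 0 < Q x) (hQsum : ∑ x, Q x = 1)
    (hV : ∀ y, 0 < V y) (hVsum : ∑ y, V y = 1)
    (hU : ∀ y, 0 < U y) (hUsum : ∑ y, U y = 1)
    (m₁ m₂ : ℝ) (hm₁ : 0 ≤ m₁) (hm₂ : 0 ≤ m₂)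
    (B : ℝ) (hB : 0 ≤ B)
    (hbddG : ∀ x, |Real.log (P x / Q x)| ≤ B)
    (hbddS : ∀ y, |Real.log (V y / U y)| ≤ B)
    (η : ℝ) (hη : η ∈ Set.Icc (0 : ℝ) 1) :
    (η ^ 2 / (4 * Real.exp (5 * B))) * (m₁ * klDiv Q P + m₂ * klDiv U V) ≤
      EQU P Q V U m₁ m₂ (-((1 - η) * (m₁ * klDiv Q P + m₂ * klDiv U V))) := by
  set D := m₁ * klDiv Q P + m₂ * klDiv U V with hD
  have hD0 : 0 ≤ D := add_nonneg (mul_nonneg hm₁ (klDiv_nonneg_of_pos hP hPsum hQ hQsum))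
    (mul_nonneg hm₂ (klDiv_nonneg_of_pos hV hVsum hU hUsum))
  have hE : 1 ≤ Real.exp (2 * B) := Real.one_le_exp (by positivity)
  obtain ⟨hη0, hη1⟩ := hη
  set t := η / (2 * Real.exp (2 * B)) with ht_def
  have ht : t ∈ Set.Icc (0 : ℝ) 1 :=
    ⟨by positivity, (div_le_one (by positivity)).2 (by linarith)⟩
  have hcont : Continuous fun s : ℝ => s * -((1 - η) * D) - psiQU P Q V U m₁ m₂ s :=
    (continuous_id.mul continuous_const).sub
      ((continuous_const.mul (continuous_log_sum_mul_rpow hP hQ)).add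
        (continuous_const.mul (continuous_log_sum_mul_rpow hV hU)))
  have hbdd := (isCompact_Icc (a := (0 : ℝ)) (b := 1)).bddAbove_image hcont.continuousOn
  have hpsi : psiQU P Q V U m₁ m₂ t ≤ -(t * D) + t ^ 2 * Real.exp (2 * B) * D := by
    have h₁ := mul_le_mul_of_nonneg_left
      (log_sum_mul_rpow_le hP hPsum hQ hQsum hbddG ht) hm₁
    have h₂ := mul_le_mul_of_nonneg_left
      (log_sum_mul_rpow_le hV hVsum hU hUsum hbddS ht) hm₂
    rw [psiQU, hD]
    linarith
  calc η ^ 2 / (4 * Real.exp (5 * B)) * D ≤ η ^ 2 / (4 * Real.exp (2 * B)) * D := by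
        gcongr
        norm_num
    _ = t * -((1 - η) * D) - (-(t * D) + t ^ 2 * Real.exp (2 * B) * D) := by
        rw [ht_def]
        field_simp
        ring
    _ ≤ t * -((1 - η) * D) - psiQU P Q V U m₁ m₂ t := by gcongr
    _ ≤ EQU P Q V U m₁ m₂ (-((1 - η) * D)) := le_csSup hbdd ⟨t, ht, rfl⟩
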